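/- arXiv:2312.06981 — 4 statements merged into one kernel-verified Lean document; each statement's English description precedes it below -/
import Mathlib

section
/- For any integer k ≥ 2, there exist positive integers m and n such that the system of simultaneous congruences X ≡ 2^{2m−1} − 1 (mod 2^{2m}) and 3^{k−1}·X ≡ 2^{2n} − 1 (mod 2^{2n+1}) has an integer solution X. -/
theorem exists_solution_of_congruence_system (k : ℕ) (hk : 2 ≤ k) :
    ∃ m n : ℕ, 0 < m ∧ 0 < n ∧ ∃ X : ℤ,
      X ≡ 2 ^ (2 * m - 1) - 1 [ZMOD 2 ^ (2 * m)] ∧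
      3 ^ (k - 1) * X ≡ 2 ^ (2 * n) - 1 [ZMOD 2 ^ (2 * n + 1)] := by
  have hodd : Odd ((3 : ℕ) ^ (k - 1)) := Odd.pow (by decide)
  have hgt : 1 < (3 : ℕ) ^ (k - 1) := Nat.one_lt_pow (by omega) (by norm_num)
  obtain ⟨a, c, hc, hac⟩ := Nat.exists_eq_two_pow_mul_odd (n := 3 ^ (k - 1) - 1) (by omega)
  have hT : (3 : ℤ) ^ (k - 1) = 1 + 2 ^ a * (c : ℤ) := by
    have : (3 : ℕ) ^ (k - 1) = 1 + 2 ^ a * c := by omega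
    exact_mod_cast this
  have hoddZ : Odd ((3 : ℤ) ^ (k - 1)) := Odd.pow (by decide)
  have ha : a ≠ 0 := by
    rintro rfl
    obtain ⟨x, hx⟩ := hc
    obtain ⟨y, hy⟩ := hodd
    omega
  generalize (3 : ℤ) ^ (k - 1) = T at *
  obtain ⟨d, rfl⟩ := hc
  push_cast at hT
  obtain ⟨t, ht⟩ := hoddZ
  rcases Nat.even_or_odd' a with ⟨b, rfl | rfl⟩
  · refine ⟨b + 1, b, by omega, by omega, 2 ^ (2 * b + 1) - 1, ?_, ?_⟩
    · rw [show 2 * (b + 1) - 1 = 2 * b + 1 by omega]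
    · apply Int.ModEq.symm
      rw [Int.modEq_iff_dvd]
      refine ⟨T - d - 1, ?_⟩
      rw [pow_succ]
      linear_combination -hT
  · refine ⟨b + 1, b + 1, by omega, by omega, T * (2 * d + 3) * 2 ^ (2 * b + 1) - 1, ?_, ?_⟩
    · rw [show 2 * (b + 1) - 1 = 2 * b + 1 by omega]
      apply Int.ModEq.symm
      rw [Int.modEq_iff_dvd]
      refine ⟨t * (2 * d + 3) + d + 1, ?_⟩
      rw [show 2 * (b + 1) = 2 * b + 1 + 1 by ring, pow_succ _ (2 * b + 1)]
      linear_combination (2 * d + 3) * 2 ^ (2 * b + 1) * ht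
    · apply Int.ModEq.symm
      rw [Int.modEq_iff_dvd]
      refine ⟨(t ^ 2 + t) * (2 * d + 3), ?_⟩
      rw [show 2 * (b + 1) + 1 = 2 * b + 1 + 1 + 1 by ring,
        show 2 * (b + 1) = 2 * b + 1 + 1 by ring, pow_succ _ (2 * b + 1 + 1),
        pow_succ _ (2 * b + 1)]
      linear_combination (2 * d + 3) * 2 ^ (2 * b + 1) * (T + 2 * t + 1) * ht - hT
end

section
/- Let x and m be positive integers with x ≡ 2^{2m−1} − 1 (mod 2^{2m}). Then t(1 + x) = t(x). -/
/-- The Thue–Morse indicator: `thueMorse n = 1` if the number of ones in the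
binary expansion of `n` is odd, and `0` if it is even. -/
def thueMorse (n : ℕ) : ℕ := (Nat.digits 2 n).sum % 2

theorem digsum_even (n : ℕ) : (Nat.digits 2 (2 * n)).sum = (Nat.digits 2 n).sum := by
  rcases Nat.eq_zero_or_pos n with rfl | h
  · simp
  · rw [Nat.digits_def' (by norm_num) (by omega)]
    have h1 : 2 * n % 2 = 0 := by omega
    have h2 : 2 * n / 2 = n := by omega
    rw [h1, h2]; simp

theorem digsum_odd (n : ℕ) : (Nat.digits 2 (2 * n + 1)).sum = (Nat.digits 2 n).sum + 1 := by
  rw [Nat.digits_def' (by norm_num) (by omega)]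
  have h1 : (2 * n + 1) % 2 = 1 := by omega
  have h2 : (2 * n + 1) / 2 = n := by omega
  rw [h1, h2, List.sum_cons, add_comm]

theorem digsum_pow (k n : ℕ) : (Nat.digits 2 (2 ^ k * n)).sum = (Nat.digits 2 n).sum := by
  induction k with
  | zero => simp
  | succ k ih => rw [pow_succ', mul_assoc, digsum_even, ih]

theorem digsum_pred (k n y : ℕ) (h : y + 1 = 2 ^ k * (n + 1)) :
    (Nat.digits 2 y).sum = (Nat.digits 2 n).sum + k := by
  induction k generalizing y with
  | zero =>
    have : y = n := by simpa using h
    simp [this]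
  | succ k ih =>
    rw [pow_succ', mul_assoc] at h
    obtain ⟨z, hz⟩ : ∃ z, y = 2 * z + 1 := ⟨y / 2, by omega⟩
    rw [hz, digsum_odd, ih z (by omega)]
    omega

theorem thueMorse_succ_eq_of_congruence (x m : ℕ) (hx : 0 < x) (hm : 0 < m)
    (hcong : (x : ℤ) ≡ 2 ^ (2 * m - 1) - 1 [ZMOD 2 ^ (2 * m)]) :
    thueMorse (1 + x) = thueMorse x := by
  obtain ⟨k, rfl⟩ : ∃ k, m = k + 1 := ⟨m - 1, by omega⟩
  have e1 : 2 * (k + 1) - 1 = 2 * k + 1 := by omega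
  have e2 : 2 * (k + 1) = (2 * k + 1) + 1 := by omega
  rw [e1, e2] at hcong
  obtain ⟨c, hc⟩ := hcong.symm.dvd
  have hP : (0 : ℤ) < 2 ^ (2 * k + 1) := by positivity
  have hc0 : 0 ≤ c := by
    by_contra hneg
    have h1 : c ≤ -1 := by omega
    rw [pow_succ _ (2 * k + 1)] at hc
    nlinarith
  lift c to ℕ using hc0
  have hx1 : x + 1 = 2 ^ (2 * k + 1) * (2 * c + 1) := by
    zify
    rw [pow_succ _ (2 * k + 1)] at hc
    linear_combination hc
  unfold thueMorse
  rw [digsum_pred _ _ _ hx1, add_comm 1 x, hx1, digsum_pow, digsum_odd, digsum_even]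
  omega
end

section
/- Let k ≥ 2 be an integer, let ν(k) denote the 2-adic valuation of k, and let m, n, x be positive integers satisfying x ≡ 2^{2m−1} − 1 (mod 2^{2m}) and 3^{k−1}·x ≡ 2^{2n} − 1 (mod 2^{2n+1}). Let y be a positive integer with y ≤ 2^{2m+2n+1} and (k·2^{−ν(k)})·y ≡ x (mod 2^{2m+2n+1}). Then there exists N₀ such that for every integer N ≥ N₀ the following holds: for every integer j with 0 ≤ j ≤ 2^N − 1, and for every j of the form j = 2^N + 2h with 0 ≤ h ≤ 2^{N−3}, one has t((y·2^{kN−ν(k)} + j)^k) = t((y·2^{kN−ν(k)+1} + j)^k). -/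
theorem tm_two_mul (n : ℕ) : thueMorse (2 * n) = thueMorse n := by
  rcases Nat.eq_zero_or_pos n with rfl | h
  · simp
  · unfold thueMorse
    rw [Nat.digits_def' (by norm_num) (by omega)]
    simp

theorem tm_two_mul_add (n : ℕ) : thueMorse (2 * n + 1) = (1 + thueMorse n) % 2 := by
  unfold thueMorse
  rw [Nat.digits_def' (by norm_num) (by omega)]
  have h1 : (2 * n + 1) % 2 = 1 := by omega
  have h2 : (2 * n + 1) / 2 = n := by omega
  rw [h1, h2]
  simp [Nat.add_mod]

theorem tm_lt (n : ℕ) : thueMorse n % 2 = thueMorse n := by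
  unfold thueMorse; omega

theorem tm_split (s a b : ℕ) (h : a < 2 ^ s) :
    thueMorse (a + 2 ^ s * b) = (thueMorse a + thueMorse b) % 2 := by
  induction s generalizing a with
  | zero =>
    have : a = 0 := by simpa using h
    subst this
    have h0 : thueMorse 0 = 0 := by simp [thueMorse]
    simp [h0, tm_lt]
  | succ s ih =>
    have hp : 2 ^ (s + 1) = 2 * 2 ^ s := by ring
    rw [hp] at h
    have hi := ih (a / 2) (by omega)
    rcases Nat.even_or_odd' a with ⟨c, rfl | rfl⟩
    · have e : 2 * c / 2 = c := by omega
      rw [e] at hi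
      have : 2 * c + 2 ^ (s + 1) * b = 2 * (c + 2 ^ s * b) := by ring
      rw [this, tm_two_mul, tm_two_mul, hi]
    · have e : (2 * c + 1) / 2 = c := by omega
      rw [e] at hi
      have : 2 * c + 1 + 2 ^ (s + 1) * b = 2 * (c + 2 ^ s * b) + 1 := by ring
      rw [this, tm_two_mul_add, tm_two_mul_add, hi]
      omega

theorem tm_shift (s b : ℕ) : thueMorse (2 ^ s * b) = thueMorse b := by
  have := tm_split s 0 b (by positivity)
  have h0 : thueMorse 0 = 0 := by simp [thueMorse]
  simpa [h0, tm_lt] using this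

theorem tm_sum (e : ℕ) (r : ℕ) : ∀ (c : ℕ → ℕ), (∀ i < r, c i < 2 ^ e) →
    thueMorse (∑ i ∈ Finset.range r, c i * (2 ^ e) ^ i) =
      (∑ i ∈ Finset.range r, thueMorse (c i)) % 2 := by
  induction r with
  | zero => intro c _; simp [thueMorse]
  | succ r ih =>
    intro c hc
    have hi := ih (fun i => c (i + 1)) (fun i hi => hc _ (by omega))
    rw [Finset.sum_range_succ', Finset.sum_range_succ']
    have : ∑ i ∈ Finset.range r, c (i + 1) * (2 ^ e) ^ (i + 1) + c 0 * (2 ^ e) ^ 0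
        = c 0 + 2 ^ e * ∑ i ∈ Finset.range r, c (i + 1) * (2 ^ e) ^ i := by
      rw [Finset.mul_sum, add_comm]
      congr 1
      · simp
      · exact Finset.sum_congr rfl fun i _ => by ring
    rw [this, tm_split _ _ _ (hc 0 (by omega)), hi]
    omega

theorem tm_core (k j y e S : ℕ) (hk : 1 ≤ k)
    (hs : ∀ i < k, k.choose (i + 1) * y ^ (i + 1) * j ^ (k - (i + 1)) < 2 ^ e)
    (hj : j ^ k < 2 ^ S) (hd : 2 ^ S ∣ k * 2 ^ e * j ^ (k - 1)) (hS : S ≤ 2 * e) :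
    thueMorse ((y * 2 ^ e + j) ^ k) = (thueMorse (j ^ k) +
      (∑ i ∈ Finset.range k,
        thueMorse (k.choose (i + 1) * y ^ (i + 1) * j ^ (k - (i + 1)))) % 2) % 2 := by
  set c : ℕ → ℕ := fun i => k.choose (i + 1) * y ^ (i + 1) * j ^ (k - (i + 1)) with hc
  have h1 := tm_sum e k c hs
  set R := ∑ i ∈ Finset.range k, c i * (2 ^ e) ^ i with hR
  have hexp : (y * 2 ^ e + j) ^ k = j ^ k + 2 ^ e * R := by
    rw [add_pow, Finset.sum_range_succ', hR, Finset.mul_sum, add_comm]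
    congr 1
    · simp
    · refine Finset.sum_congr rfl fun i _ => ?_
      simp only [hc, Nat.cast_id]
      rw [mul_pow]; ring
  have hdv : 2 ^ S ∣ 2 ^ e * R := by
    rw [hR, Finset.mul_sum]
    refine Finset.dvd_sum fun i _ => ?_
    rcases i with _ | i
    · refine hd.trans ⟨y, ?_⟩
      simp [hc]; ring
    · refine (pow_dvd_pow 2 hS).trans ⟨c (i + 1) * (2 ^ e) ^ i, ?_⟩
      ring
  obtain ⟨Q, hQ⟩ := hdv
  have h2 : thueMorse Q = thueMorse R := by
    rw [← tm_shift S Q, ← hQ, tm_shift]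
  rw [hexp, hQ, tm_split S _ _ hj, h2, h1]

theorem tm_main (k j y e S : ℕ) (hk : 1 ≤ k)
    (hs : ∀ i < k, k.choose (i + 1) * y ^ (i + 1) * j ^ (k - (i + 1)) < 2 ^ e)
    (hj : j ^ k < 2 ^ S) (hd : 2 ^ S ∣ k * 2 ^ e * j ^ (k - 1)) (hS : S ≤ 2 * e) :
    thueMorse ((y * 2 ^ e + j) ^ k) = thueMorse ((y * 2 ^ (e + 1) + j) ^ k) := by
  rw [tm_core k j y e S hk hs hj hd hS, tm_core k j y (e + 1) S hk _ hj _ (by omega)]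
  · intro i hi
    exact (hs i hi).trans_le (Nat.pow_le_pow_right (by norm_num) (by omega))
  · exact hd.trans ⟨2, by ring⟩

theorem tm_size (k j y N c v : ℕ) (hy : y ≤ 2 ^ c) (hj : j ≤ 2 ^ (N + 1)) (hv : v < k)
    (hN : 3 + 4 * k + k * c ≤ N) :
    ∀ i < k, k.choose (i + 1) * y ^ (i + 1) * j ^ (k - (i + 1)) < 2 ^ (k * N - v) := by
  intro i hi
  have a1 : k.choose (i + 1) ≤ 2 ^ k := Nat.choose_le_two_pow _ _
  have a2 : y ^ (i + 1) ≤ 2 ^ (c * k) := by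
    calc y ^ (i + 1) ≤ (2 ^ c) ^ (i + 1) := Nat.pow_le_pow_left hy _
      _ ≤ (2 ^ c) ^ k := Nat.pow_le_pow_right (by positivity) (by omega)
      _ = _ := by rw [pow_mul]
  have a3 : j ^ (k - (i + 1)) ≤ 2 ^ ((N + 1) * (k - 1)) := by
    calc j ^ (k - (i + 1)) ≤ (2 ^ (N + 1)) ^ (k - (i + 1)) := Nat.pow_le_pow_left hj _
      _ ≤ (2 ^ (N + 1)) ^ (k - 1) := Nat.pow_le_pow_right (by positivity) (by omega)
      _ = _ := by rw [pow_mul]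
  calc _ ≤ 2 ^ k * 2 ^ (c * k) * 2 ^ ((N + 1) * (k - 1)) := by gcongr
    _ = 2 ^ (k + c * k + (N + 1) * (k - 1)) := by rw [pow_add, pow_add]
    _ < _ := by
      apply Nat.pow_lt_pow_right (by norm_num)
      obtain ⟨l, rfl⟩ : ∃ l, k = l + 1 := ⟨k - 1, by omega⟩
      have : (l + 1) * N = N * l + N := by ring
      have h2 : (N + 1) * l = N * l + l := by ring
      have h3 : c * (l + 1) = (l + 1) * c := by ring
      simp only [Nat.add_sub_cancel]
      omega

theorem thueMorse_eq_on_initial_range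
    (k : ℕ) (hk : 2 ≤ k) (m n x y : ℕ)
    (hm : 0 < m) (hn : 0 < n) (hx : 0 < x) (hy : 0 < y)
    (hx1 : (x : ℤ) ≡ 2 ^ (2 * m - 1) - 1 [ZMOD 2 ^ (2 * m)])
    (hx2 : (3 : ℤ) ^ (k - 1) * x ≡ 2 ^ (2 * n) - 1 [ZMOD 2 ^ (2 * n + 1)])
    (hyle : y ≤ 2 ^ (2 * m + 2 * n + 1))
    (hy2 : ((k / 2 ^ (padicValNat 2 k) * y : ℕ) : ℤ) ≡ (x : ℤ)
      [ZMOD 2 ^ (2 * m + 2 * n + 1)]) :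
    ∃ N₀ : ℕ, ∀ N ≥ N₀,
      (∀ j ≤ 2 ^ N - 1,
        thueMorse ((y * 2 ^ (k * N - padicValNat 2 k) + j) ^ k) =
        thueMorse ((y * 2 ^ (k * N - padicValNat 2 k + 1) + j) ^ k)) ∧
      (∀ h ≤ 2 ^ (N - 3),
        thueMorse ((y * 2 ^ (k * N - padicValNat 2 k) + 2 ^ N + 2 * h) ^ k) =
        thueMorse ((y * 2 ^ (k * N - padicValNat 2 k + 1) + 2 ^ N + 2 * h) ^ k)) := by
  set v := padicValNat 2 k with hv
  have hdk : 2 ^ v ∣ k := pow_padicValNat_dvd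
  have hvk : v < k := lt_of_lt_of_le Nat.lt_two_pow_self (Nat.le_of_dvd (by omega) hdk)
  refine ⟨3 + 4 * k + k * (2 * m + 2 * n + 1), fun N hN => ?_⟩
  have hkN : 2 * N ≤ k * N := Nat.mul_le_mul_right _ hk
  have hN4 : 3 + 4 * k ≤ N := le_trans (Nat.le_add_right _ _) hN
  have hdiv : 2 ^ (k * N) ∣ k * 2 ^ (k * N - v) := by
    have : k * N = v + (k * N - v) := by omega
    nth_rewrite 1 [this]
    rw [pow_add]
    exact Nat.mul_dvd_mul_right hdk _
  have hp : 2 ^ (N + 1) = 2 * 2 ^ N := by ring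
  have hpos : 0 < 2 ^ N := by positivity
  constructor
  · intro j hj
    apply tm_main k j y _ (k * N) (by omega)
    · exact tm_size k j y N _ v hyle (by omega) hvk hN
    · rw [mul_comm k N, pow_mul]
      exact Nat.pow_lt_pow_left (by omega) (by omega)
    · exact Dvd.dvd.mul_right hdiv _
    · omega
  · intro h hh
    have hp3 : 2 ^ N = 8 * 2 ^ (N - 3) := by
      have : N = (N - 3) + 3 := by omega
      nth_rewrite 1 [this]
      ring
    rw [add_assoc, add_assoc]
    set j := 2 ^ N + 2 * h with hjd
    have hj4 : 4 * j ≤ 5 * 2 ^ N := by omega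
    apply tm_main k j y _ (k * N + (k - 1)) (by omega)
    · exact tm_size k j y N _ v hyle (by omega) hvk hN
    · obtain ⟨l, rfl⟩ : ∃ l, k = l + 2 := ⟨k - 2, by omega⟩
      have b1 : j ^ l ≤ (2 ^ (N + 1)) ^ l := Nat.pow_le_pow_left (by omega) _
      have b2 : j ^ 2 < 2 * (2 ^ N) ^ 2 := by nlinarith
      calc j ^ (l + 2) = j ^ l * j ^ 2 := by ring
        _ ≤ (2 ^ (N + 1)) ^ l * j ^ 2 := Nat.mul_le_mul_right _ b1
        _ < (2 ^ (N + 1)) ^ l * (2 * (2 ^ N) ^ 2) :=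
            Nat.mul_lt_mul_of_pos_left b2 (by positivity)
        _ = 2 ^ ((l + 2) * N + (l + 2 - 1)) := by
            have : l + 2 - 1 = l + 1 := by omega
            rw [this]; ring
    · rw [pow_add]
      apply Nat.mul_dvd_mul hdiv
      apply pow_dvd_pow_of_dvd
      omega
    · omega
end

section
/- Let k ≥ 2 be an integer, let ν(k) denote the 2-adic valuation of k, and let m, n, x be positive integers satisfying x ≡ 2^{2m−1} − 1 (mod 2^{2m}) and 3^{k−1}·x ≡ 2^{2n} − 1 (mod 2^{2n+1}). Let y be a positive integer with y ≤ 2^{2m+2n+1} and (k·2^{−ν(k)})·y ≡ x (mod 2^{2m+2n+1}). Then there exists N₀ such that for every integer N ≥ N₀: t((y·2^{kN−ν(k)} + 2^N + 1)^k) ≠ t((y·2^{kN−ν(k)+1} + 2^N + 1)^k), and t((y·2^{kN−ν(k)} + 2^N + 3)^k) = t((y·2^{kN−ν(k)+1} + 2^N + 3)^k). -/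
def tmT (n : ℕ) : ZMod 2 := ((Nat.digits 2 n).sum : ℕ)

lemma tmT_eq_iff (a b : ℕ) : thueMorse a = thueMorse b ↔ tmT a = tmT b := by
  unfold thueMorse tmT
  rw [ZMod.natCast_eq_natCast_iff]
  rfl

lemma tmT_zero : tmT 0 = 0 := by simp [tmT]

lemma tmT_two_mul (n : ℕ) : tmT (2 * n) = tmT n := by
  rcases Nat.eq_zero_or_pos n with rfl | h
  · simp
  · unfold tmT
    rw [Nat.digits_def' (by norm_num) (by omega)]
    simp

lemma tmT_two_mul_add (n : ℕ) : tmT (2 * n + 1) = tmT n + 1 := by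
  unfold tmT
  rw [Nat.digits_def' (by norm_num) (by omega)]
  have h1 : (2 * n + 1) % 2 = 1 := by omega
  have h2 : (2 * n + 1) / 2 = n := by omega
  rw [h1, h2]
  simp [add_comm]

lemma tmT_split (M : ℕ) : ∀ A B : ℕ, A < 2 ^ M → tmT (A + 2 ^ M * B) = tmT A + tmT B := by
  induction M with
  | zero =>
    intro A B h
    have : A = 0 := by simpa using h
    subst this
    simp [tmT_zero]
  | succ M ih =>
    intro A B h
    rw [pow_succ] at h
    rcases Nat.even_or_odd' A with ⟨c, rfl | rfl⟩
    · have e : 2 * c + 2 ^ (M + 1) * B = 2 * (c + 2 ^ M * B) := by ring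
      rw [e, tmT_two_mul, tmT_two_mul, ih _ _ (by omega)]
    · have e : 2 * c + 1 + 2 ^ (M + 1) * B = 2 * (c + 2 ^ M * B) + 1 := by ring
      rw [e, tmT_two_mul_add, tmT_two_mul_add, ih _ _ (by omega)]
      ring

lemma tmT_pow_mul (j n : ℕ) : tmT (2 ^ j * n) = tmT n := by
  have := tmT_split j 0 n (by positivity)
  simpa [tmT_zero] using this

lemma tmT_ones (r : ℕ) : tmT (2 ^ r - 1) = r := by
  induction r with
  | zero => simp [tmT_zero]
  | succ r ih =>
    have h : 0 < 2 ^ r := by positivity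
    have e : 2 ^ (r + 1) - 1 = 2 * (2 ^ r - 1) + 1 := by rw [pow_succ]; omega
    rw [e, tmT_two_mul_add, ih]
    push_cast
    rfl

lemma tmT_trail (r z : ℕ) (h : (z : ℤ) ≡ 2 ^ r - 1 [ZMOD 2 ^ (r + 1)]) :
    tmT (1 + 2 * z) = tmT (1 + z) + r := by
  have hp : 0 < 2 ^ r := by positivity
  obtain ⟨w, hw⟩ : ∃ w : ℕ, z = (2 ^ r - 1) + 2 ^ r * (2 * w) := by
    have h1 : (z : ℤ) ≡ ((2 ^ r - 1 : ℕ) : ℤ) [ZMOD ((2 ^ (r + 1) : ℕ) : ℤ)] := by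
      push_cast [Nat.cast_sub (show 1 ≤ 2 ^ r from hp)]
      exact h
    rw [Int.natCast_modEq_iff] at h1
    have h2 : z % 2 ^ (r + 1) = 2 ^ r - 1 := by
      rw [h1]; apply Nat.mod_eq_of_lt; rw [pow_succ]; omega
    refine ⟨z / 2 ^ (r + 1), ?_⟩
    have h3 := Nat.mod_add_div z (2 ^ (r + 1))
    rw [h2] at h3
    rw [← mul_assoc, ← pow_succ]
    exact h3.symm
  have e1 : 1 + z = 2 ^ r * (2 * w + 1) := by
    rw [mul_add, mul_one]; omega
  have e2 : tmT z = r + tmT w := by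
    rw [hw, tmT_split _ _ _ (by omega), tmT_ones, tmT_two_mul]
  rw [e1, tmT_pow_mul, tmT_two_mul_add, add_comm 1, tmT_two_mul_add, e2]
  ring

lemma tmT_sum (M A : ℕ) (c : ℕ → ℕ) (hA : A < 2 ^ (2 * M)) (L : ℕ)
    (hc : ∀ j < L, c j < 2 ^ M) :
    A + ∑ j ∈ Finset.range L, 2 ^ (M * (j + 2)) * c j < 2 ^ (M * (L + 2)) ∧
    tmT (A + ∑ j ∈ Finset.range L, 2 ^ (M * (j + 2)) * c j)
      = tmT A + ∑ j ∈ Finset.range L, tmT (c j) := by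
  induction L with
  | zero => simpa [mul_comm] using hA
  | succ L ih =>
    obtain ⟨h1, h2⟩ := ih (fun j hj => hc j (by omega))
    rw [Finset.sum_range_succ, Finset.sum_range_succ, ← add_assoc, ← add_assoc]
    refine ⟨?_, ?_⟩
    · have h3 : c L + 1 ≤ 2 ^ M := hc L (by omega)
      have h4 : 2 ^ (M * (L + 2)) * (c L + 1) ≤ 2 ^ (M * (L + 2)) * 2 ^ M :=
        Nat.mul_le_mul_left _ h3
      have e : 2 ^ (M * (L + 1 + 2)) = 2 ^ (M * (L + 2)) * 2 ^ M := by
        rw [← pow_add]; ring_nf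
      rw [e]
      rw [mul_add] at h4
      omega
    · rw [tmT_split _ _ _ h1, h2]

lemma tm_low (X a : ℕ) (j : ℕ) : ∃ W, (X + a) ^ j = a ^ j + X * W := by
  induction j with
  | zero => exact ⟨0, by simp⟩
  | succ j ih =>
    obtain ⟨W, hW⟩ := ih
    exact ⟨a ^ j + (X + a) * W, by rw [pow_succ, hW]; ring⟩

lemma tm_high (X a : ℕ) (hX : 0 < X) (j : ℕ) :
    ∃ L, (X + a) ^ (j + 1) = X ^ (j + 1) + L ∧ L ≤ X ^ j * (1 + a) ^ (j + 1) := by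
  induction j with
  | zero => exact ⟨a, by simp, by simp⟩
  | succ j ih =>
    obtain ⟨L, hL, hb⟩ := ih
    refine ⟨X * L + a * X ^ (j + 1) + a * L, by rw [pow_succ, hL]; ring, ?_⟩
    have hone : 1 ≤ (1 + a) ^ (j + 1) := Nat.one_le_pow _ _ (by omega)
    have hL2 : X ^ (j + 1) + L ≤ X ^ (j + 1) * (1 + a) ^ (j + 1) := by
      rw [← hL, ← mul_pow]
      apply Nat.pow_le_pow_left
      nlinarith
    calc X * L + a * X ^ (j + 1) + a * L
        = X * L + a * (X ^ (j + 1) + L) := by ring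
      _ ≤ X * (X ^ j * (1 + a) ^ (j + 1)) + a * (X ^ (j + 1) * (1 + a) ^ (j + 1)) := by
        gcongr
      _ = X ^ (j + 1) * (1 + a) ^ (j + 1 + 1) := by ring

lemma tm_core_s9 (k q v N M Y u a L W : ℕ) (hk : 2 ≤ k) (hq : k = 2 ^ v * q)
    (hM : v + M = k * N)
    (hu : u ^ k = 2 ^ (k * N) + L) (hL : L < 2 ^ (k * N))
    (hW : u ^ (k - 1) = a ^ (k - 1) + 2 ^ N * W)
    (hz : 1 + q * Y * a ^ (k - 1) < 2 ^ N)
    (hb : u ^ k + k * Y * u ^ (k - 1) * 2 ^ M < 2 ^ (2 * M))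
    (hc : ∀ j < k - 1, k.choose (j + 2) * Y ^ (j + 2) * u ^ (k - (j + 2)) < 2 ^ M) :
    tmT ((Y * 2 ^ M + u) ^ k) = tmT L + tmT (1 + q * Y * a ^ (k - 1)) + tmT (q * Y * W) +
      ∑ j ∈ Finset.range (k - 1), tmT (k.choose (j + 2) * Y ^ (j + 2) * u ^ (k - (j + 2))) := by
  have e : (Y * 2 ^ M + u) ^ k = (u ^ k + k * Y * u ^ (k - 1) * 2 ^ M) +
      ∑ j ∈ Finset.range (k - 1), 2 ^ (M * (j + 2)) *
        (k.choose (j + 2) * Y ^ (j + 2) * u ^ (k - (j + 2))) := by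
    rw [add_pow]
    have : k + 1 = (k - 1) + 1 + 1 := by omega
    rw [this, Finset.sum_range_succ', Finset.sum_range_succ', add_assoc, add_comm]
    congr 1
    · simp; ring
    · apply Finset.sum_congr rfl
      intro j _
      rw [pow_mul, Nat.cast_id]
      ring
  rw [e, (tmT_sum M _ _ hb (k - 1) hc).2]
  congr 1
  have e2 : u ^ k + k * Y * u ^ (k - 1) * 2 ^ M =
      L + 2 ^ (k * N) * ((1 + q * Y * a ^ (k - 1)) + 2 ^ N * (q * Y * W)) := by
    have : k * Y * u ^ (k - 1) * 2 ^ M = 2 ^ (k * N) * (q * Y * u ^ (k - 1)) := by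
      rw [← hM, pow_add]
      nth_rewrite 1 [hq]
      ring
    rw [this, hu, hW]
    ring
  rw [e2, tmT_split _ _ _ hL, tmT_split _ _ _ hz]
  ring

lemma tm_main_s9 (k q v y a : ℕ) (hk : 2 ≤ k) (hq : k = 2 ^ v * q) (ha : a ≤ 3) (r : ℕ)
    (hr : ((q * y * a ^ (k - 1) : ℕ) : ℤ) ≡ 2 ^ r - 1 [ZMOD 2 ^ (r + 1)]) :
    ∃ N₀ : ℕ, ∀ N ≥ N₀, tmT ((y * 2 ^ (k * N - v + 1) + 2 ^ N + a) ^ k) =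
      tmT ((y * 2 ^ (k * N - v) + 2 ^ N + a) ^ k) + r := by
  set E := 2 ^ k * (2 * y + 1) ^ k with hE
  set D := 1 + q * (2 * y) * a ^ (k - 1) with hD
  refine ⟨E + D + 2 * v + 2 * k + 5, fun N hN => ?_⟩
  obtain ⟨W, hW⟩ := tm_low (2 ^ N) a (k - 1)
  obtain ⟨L, hL, hLb⟩ := tm_high (2 ^ N) a (by positivity) (k - 1)
  have hk1 : k - 1 + 1 = k := by omega
  rw [hk1] at hL hLb
  rw [← pow_mul, mul_comm N k] at hL
  have hkN : k * N = (k - 1) * N + N := by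
    nth_rewrite 1 [← hk1]; ring
  have hL2 : L < 2 ^ (k * N) := by
    calc L ≤ (2 ^ N) ^ (k - 1) * (1 + a) ^ k := hLb
      _ ≤ (2 ^ N) ^ (k - 1) * (2 ^ 2) ^ k := by gcongr; omega
      _ = 2 ^ ((k - 1) * N + 2 * k) := by rw [pow_add, ← pow_mul, ← pow_mul]; ring
      _ < 2 ^ (k * N) := by apply Nat.pow_lt_pow_right (by norm_num); omega
  have hNk : N ≤ k * N := by nlinarith
  have hM : v + (k * N - v) = k * N := by omega
  set M := k * N - v with hMdef
  set u := 2 ^ N + a with hu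
  have hu0 : 1 ≤ u := by
    have : 0 < 2 ^ N := by positivity
    omega
  have hu1 : u ≤ 2 ^ (N + 1) := by
    have : 2 ^ 2 ≤ 2 ^ N := Nat.pow_le_pow_right (by norm_num) (by omega)
    rw [pow_succ]; omega
  have hEpos : 0 < E := by positivity
  have hbig : E * u ^ (k - 1) * 2 ≤ 2 ^ M := by
    calc E * u ^ (k - 1) * 2 ≤ 2 ^ E * (2 ^ (N + 1)) ^ (k - 1) * 2 := by
          gcongr
          exact Nat.lt_two_pow_self.le
      _ = 2 ^ (E + (N + 1) * (k - 1) + 1) := by rw [← pow_mul, pow_succ, pow_add 2 E]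
      _ ≤ 2 ^ M := by
          apply Nat.pow_le_pow_right (by norm_num)
          have : (N + 1) * (k - 1) = (k - 1) * N + (k - 1) := by ring
          omega
  have huk : u ^ k * 2 < 2 ^ (2 * M) := by
    calc u ^ k * 2 ≤ (2 ^ (N + 1)) ^ k * 2 := by gcongr
      _ = 2 ^ ((N + 1) * k + 1) := by rw [← pow_mul, ← pow_succ]
      _ < 2 ^ (2 * M) := by
          apply Nat.pow_lt_pow_right (by norm_num)
          have : (N + 1) * k = k * N + k := by ring
          omega
  have hEb : ∀ Y ≤ 2 * y, ∀ j, 1 ≤ j → j ≤ k →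
      k.choose j * Y ^ j * u ^ (k - j) * 2 ≤ 2 ^ M := by
    intro Y hY j hj hjk
    refine le_trans ?_ hbig
    have h1 : k.choose j ≤ 2 ^ k := Nat.choose_le_two_pow k j
    have h2 : Y ^ j ≤ (2 * y + 1) ^ k :=
      (Nat.pow_le_pow_left (by omega) j).trans (Nat.pow_le_pow_right (by omega) hjk)
    have h3 : u ^ (k - j) ≤ u ^ (k - 1) := Nat.pow_le_pow_right hu0 (by omega)
    rw [hE]
    gcongr
  have core : ∀ Y ≤ 2 * y, _ := fun Y hY => tm_core_s9 k q v N M Y u a L W hk hq hM hL hL2 hW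
    (by
      have h1 : 1 + q * Y * a ^ (k - 1) ≤ D := by rw [hD]; gcongr
      have h2 : N < 2 ^ N := Nat.lt_two_pow_self
      omega)
    (by
      have h1 := hEb Y hY 1 le_rfl (by omega)
      simp only [Nat.choose_one_right, pow_one] at h1
      have h2 : k * Y * u ^ (k - 1) * 2 * 2 ^ M ≤ 2 ^ M * 2 ^ M := Nat.mul_le_mul_right _ h1
      have h3 : 2 ^ (2 * M) = 2 ^ M * 2 ^ M := by rw [two_mul, pow_add]
      rw [h3] at huk ⊢
      nlinarith)
    (by
      intro j hj
      have h1 := hEb Y hY (j + 2) (by omega) (by omega)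
      have : 0 < 2 ^ M := by positivity
      omega)
  have e1 : y * 2 ^ (M + 1) + 2 ^ N + a = (2 * y) * 2 ^ M + u := by rw [hu]; ring
  have e2 : y * 2 ^ M + 2 ^ N + a = y * 2 ^ M + u := by rw [hu]; ring
  rw [e1, e2, core (2 * y) le_rfl, core y (by omega)]
  have f1 : 1 + q * (2 * y) * a ^ (k - 1) = 1 + 2 * (q * y * a ^ (k - 1)) := by ring
  have f2 : q * (2 * y) * W = 2 * (q * y * W) := by ring
  have f3 : ∀ j, k.choose (j + 2) * (2 * y) ^ (j + 2) * u ^ (k - (j + 2)) =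
      2 ^ (j + 2) * (k.choose (j + 2) * y ^ (j + 2) * u ^ (k - (j + 2))) := by
    intro j; rw [mul_pow]; ring
  simp only [f1, f2, f3, tmT_two_mul, tmT_pow_mul, tmT_trail r _ hr]
  ring

theorem thueMorse_ne_at_one_eq_at_three
    (k : ℕ) (hk : 2 ≤ k) (m n x y : ℕ)
    (hm : 0 < m) (hn : 0 < n) (hx : 0 < x) (hy : 0 < y)
    (hx1 : (x : ℤ) ≡ 2 ^ (2 * m - 1) - 1 [ZMOD 2 ^ (2 * m)])
    (hx2 : (3 : ℤ) ^ (k - 1) * x ≡ 2 ^ (2 * n) - 1 [ZMOD 2 ^ (2 * n + 1)])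
    (hyle : y ≤ 2 ^ (2 * m + 2 * n + 1))
    (hy2 : ((k / 2 ^ (padicValNat 2 k) * y : ℕ) : ℤ) ≡ (x : ℤ)
      [ZMOD 2 ^ (2 * m + 2 * n + 1)]) :
    ∃ N₀ : ℕ, ∀ N ≥ N₀,
      thueMorse ((y * 2 ^ (k * N - padicValNat 2 k) + 2 ^ N + 1) ^ k) ≠
        thueMorse ((y * 2 ^ (k * N - padicValNat 2 k + 1) + 2 ^ N + 1) ^ k) ∧
      thueMorse ((y * 2 ^ (k * N - padicValNat 2 k) + 2 ^ N + 3) ^ k) =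
        thueMorse ((y * 2 ^ (k * N - padicValNat 2 k + 1) + 2 ^ N + 3) ^ k) := by
  have hq : k = 2 ^ (padicValNat 2 k) * (k / 2 ^ (padicValNat 2 k)) :=
    (Nat.mul_div_cancel' pow_padicValNat_dvd).symm
  generalize padicValNat 2 k = v at *
  generalize k / 2 ^ v = q at *
  have hm1 : 2 * m - 1 + 1 = 2 * m := by omega
  obtain ⟨N1, h1⟩ := tm_main_s9 k q v y 1 hk hq (by norm_num) (2 * m - 1) (by
    rw [hm1]
    simp only [one_pow, mul_one]
    exact (hy2.of_dvd (pow_dvd_pow 2 (by omega))).trans hx1)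
  obtain ⟨N3, h3⟩ := tm_main_s9 k q v y 3 hk hq (by norm_num) (2 * n) (by
    have h := (hy2.of_dvd (pow_dvd_pow 2 (show 2 * n + 1 ≤ 2 * m + 2 * n + 1 by omega))).mul_left
      ((3 : ℤ) ^ (k - 1))
    have h' := h.trans hx2
    push_cast at h' ⊢
    rwa [mul_comm ((3 : ℤ) ^ (k - 1))] at h')
  refine ⟨N1 + N3, fun N hN => ⟨?_, ?_⟩⟩
  · rw [Ne, tmT_eq_iff, h1 N (by omega)]
    have : ((2 * m - 1 : ℕ) : ZMod 2) = 1 := by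
      rw [ZMod.natCast_eq_one_iff_odd]
      exact ⟨m - 1, by omega⟩
    rw [this]
    simp
  · rw [tmT_eq_iff, h3 N (by omega)]
    have : ((2 * n : ℕ) : ZMod 2) = 0 := by
      rw [ZMod.natCast_eq_zero_iff]
      exact ⟨n, rfl⟩
    rw [this]
    simp
end
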